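/- arXiv:math/0612509 — 2 statements merged into one kernel-verified Lean document; each statement's English description precedes it below -/
import Mathlib

section
/- Let (X,d,δ) be a weak dilatation structure whose dilatations are all linear transformations. Then all transformations Δ^x_ε(u,·) are linear: for all ε,μ ∈ Γ with ν(ε),ν(μ) ≤ 1 and all x,y,u,v ∈ X for which both sides are defined, Δ^x_ε( u, δ^y_μ v ) = δ^{Δ^x_ε(u,y)}_μ Δ^x_ε(u,v). -/
open Filter Set

/-- The filter on `Γ` corresponding to `ν(ε) → 0⁺` (the end "0" of the group `Γ`). -/
def nuFilter {Γ : Type*} (ν : Γ → ℝ) : Filter Γ :=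
  Filter.comap ν (nhdsWithin 0 (Set.Ioi 0))

/-- A weak dilatation structure `(X, d, δ)` over a commutative group `Γ` endowed with a
morphism `ν : Γ → (0,∞)` with `inf ν(Γ) = 0`: the data of a distance `d`, dilatations
`δ ε x : X → X` based at every point `x` of every coefficient `ε ∈ Γ`, satisfying the
axioms A0–A3, together with the limit distances `d^x = dx x`, all nondegenerate. -/
structure WeakDilStruct (Γ : Type*) [CommGroup Γ] (X : Type*) where
  /-- the group morphism `ν : Γ → (0,∞)` -/
  ν : Γ → ℝ
  ν_pos : ∀ ε, 0 < ν ε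
  ν_hom : ∀ ε μ, ν (ε * μ) = ν ε * ν μ
  ν_inf : ∀ a : ℝ, 0 < a → ∃ ε, ν ε < a
  /-- the distance on `X` -/
  d : X → X → ℝ
  d_self : ∀ x, d x x = 0
  d_symm : ∀ x y, d x y = d y x
  d_triangle : ∀ x y z, d x z ≤ d x y + d y z
  d_nondeg : ∀ x y, d x y = 0 → x = y
  /-- the dilatation of coefficient `ε` based at `x` -/
  δ : Γ → X → X → X
  /-- the radius `A > 1` from axiom A0 -/
  A : ℝ
  one_lt_A : 1 < A
  δ_fix : ∀ ε x, δ ε x x = x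
  δ_one : ∀ x u, δ 1 x u = u
  δ_comp : ∀ ε μ x u, δ ε x (δ μ x u) = δ (ε * μ) x u
  δ_inv : ∀ ε x u, δ ε⁻¹ x (δ ε x u) = u
  δ_cont : ∀ (ε : Γ) (x y : X), ∀ η : ℝ, 0 < η → ∃ θ : ℝ, 0 < θ ∧
      ∀ y' : X, d y y' < θ → d (δ ε x y) (δ ε x y') < η
  δ_lim : ∀ x y : X, Tendsto (fun ε => d (δ ε x y) x) (nuFilter ν) (nhds 0)
  /-- the limit distance `d^x` of axiom A3 -/
  dx : X → X → X → ℝ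
  axA3 : ∀ η : ℝ, 0 < η → ∃ a : ℝ, 0 < a ∧ ∀ ε, ν ε < a → ∀ x u v : X,
      d x u ≤ A → d x v ≤ A → |d (δ ε x u) (δ ε x v) / ν ε - dx x u v| ≤ η
  dx_nondeg : ∀ x u v : X, d x u ≤ A → d x v ≤ A → dx x u v = 0 → u = v

namespace WeakDilStruct

variable {Γ : Type*} [CommGroup Γ] {X : Type*}

/-- the approximate sum operation `Σ^x_ε(u,v) = δ^x_{ε⁻¹} δ^{δ^x_ε u}_ε v` -/
def sigmaE (S : WeakDilStruct Γ X) (ε : Γ) (x u v : X) : X :=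
  S.δ ε⁻¹ x (S.δ ε (S.δ ε x u) v)

/-- the approximate difference operation `Δ^x_ε(u,v) = δ^{δ^x_ε u}_{ε⁻¹} δ^x_ε v` -/
def deltaE (S : WeakDilStruct Γ X) (ε : Γ) (x u v : X) : X :=
  S.δ ε⁻¹ (S.δ ε x u) (S.δ ε x v)

/-- the approximate inverse `inv^x_ε(u) = Δ^x_ε(u,x)` -/
def invE (S : WeakDilStruct Γ X) (ε : Γ) (x u : X) : X :=
  S.deltaE ε x u x

end WeakDilStruct

/-- A transformation `f : X → X` is linear for a weak dilatation structure if it is Lipschitz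
and it commutes with dilatations: `f (δ^x_ε u) = δ^{f x}_ε (f u)` for `ν(ε) < 1`. -/
def WeakDilStruct.IsLinear {Γ : Type*} [CommGroup Γ] {X : Type*}
    (S : WeakDilStruct Γ X) (f : X → X) : Prop :=
  (∃ L : ℝ, 0 < L ∧ ∀ u v : X, S.d (f u) (f v) ≤ L * S.d u v) ∧
  (∀ ε : Γ, S.ν ε < 1 → ∀ x u : X, f (S.δ ε x u) = S.δ ε (f x) (f u))

namespace WeakDilStruct

theorem δ_inv' {Γ : Type*} [CommGroup Γ] {X : Type*} (S : WeakDilStruct Γ X)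
    (ε : Γ) (x u : X) : S.δ ε x (S.δ ε⁻¹ x u) = u := by
  rw [S.δ_comp, mul_inv_cancel, S.δ_one]

theorem δ_injective {Γ : Type*} [CommGroup Γ] {X : Type*} (S : WeakDilStruct Γ X)
    (ε : Γ) (x : X) : Function.Injective (S.δ ε x) :=
  Function.LeftInverse.injective (S.δ_inv ε x)

/-- A linear transformation commutes with the dilatations of every coefficient. -/
theorem IsLinear.map_δ {Γ : Type*} [CommGroup Γ] {X : Type*} {S : WeakDilStruct Γ X}
    {f : X → X} (hf : S.IsLinear f) {μ : Γ} (hμ : S.ν μ ≤ 1) (x u : X) :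
    f (S.δ μ x u) = S.δ μ (f x) (f u) := by
  obtain ⟨κ, hκ⟩ := S.ν_inf 1 one_pos
  have hκμ : S.ν (κ * μ) < 1 := by
    rw [S.ν_hom]
    exact (mul_le_of_le_one_right (S.ν_pos κ).le hμ).trans_lt hκ
  apply S.δ_injective κ (f x)
  rw [← hf.2 κ hκ, S.δ_comp, S.δ_comp, hf.2 _ hκμ]

end WeakDilStruct

/-- **Theorem.** Let `(X,d,δ)` be a weak dilatation structure whose dilatations are all linear
transformations. Then all transformations `Δ^x_ε(u,·)` are linear: for all `ε, μ ∈ Γ` with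
`ν(ε), ν(μ) ≤ 1` and all `x, y, u, v ∈ X`,
`Δ^x_ε(u, δ^y_μ v) = δ^{Δ^x_ε(u,y)}_μ Δ^x_ε(u,v)`. -/
theorem deltaE_linear_of_linear_dilatations {Γ : Type*} [CommGroup Γ] {X : Type*}
    (S : WeakDilStruct Γ X)
    (hlin : ∀ μ : Γ, S.ν μ ≤ 1 → ∀ y : X, S.IsLinear (S.δ μ y)) :
    ∀ (ε μ : Γ), S.ν ε ≤ 1 → S.ν μ ≤ 1 → ∀ x y u v : X,
      S.deltaE ε x u (S.δ μ y v)
        = S.δ μ (S.deltaE ε x u y) (S.deltaE ε x u v) := by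
  intro ε μ hε hμ x y u v
  apply S.δ_injective ε (S.δ ε x u)
  rw [(hlin ε hε _).map_δ hμ]
  simp only [WeakDilStruct.deltaE, S.δ_inv']
  exact (hlin ε hε x).map_δ hμ y v
end

section
/- Let (X,d,δ) be a strong dilatation structure whose dilatations are all linear transformations. Then for all x,u,v ∈ X sufficiently close and all μ ∈ Γ with ν(μ) < 1, δ^u_μ v = Σ^x( u, δ^x_μ Δ^x(u,v) ); that is, the dilatations are exactly the dilatations of the dilatation structure of the conical group T_xX = (U(x), Σ^x, δ^x). Conversely, the dilatations of the dilatation structure of any conical group are linear. -/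
open Filter Set

/-- A (strong) dilatation structure: a weak dilatation structure also satisfying axiom A4,
with limit difference operation `Δ^x = Δ x`. -/
structure DilStruct (Γ : Type*) [CommGroup Γ] (X : Type*) extends WeakDilStruct Γ X where
  /-- the limit difference operation `Δ^x(u,v)` of axiom A4 -/
  Δ : X → X → X → X
  axA4 : ∀ η : ℝ, 0 < η → ∃ a : ℝ, 0 < a ∧ ∀ ε, ν ε < a → ∀ x u v : X,
      d x u ≤ A → d x v ≤ A →
      d (δ ε⁻¹ (δ ε x u) (δ ε x v)) (Δ x u v) ≤ η

theorem eventually_nuFilter {Γ : Type*} {ν : Γ → ℝ} (hν : ∀ ε, 0 < ν ε) {p : Γ → Prop} :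
    (∀ᶠ ε in nuFilter ν, p ε) ↔ ∃ a : ℝ, 0 < a ∧ ∀ ε, ν ε < a → p ε := by
  rw [nuFilter, ((nhdsGT_basis (0 : ℝ)).comap ν).eventually_iff]
  constructor
  · rintro ⟨a, ha, h⟩
    exact ⟨a, ha, fun ε hε => h ⟨hν ε, hε⟩⟩
  · rintro ⟨a, ha, h⟩
    exact ⟨a, ha, fun ε hε => h ε hε.2⟩

/-- A family of globally defined dilatations on a metric space, each of which is an automorphism
of the whole family, with a uniform contraction estimate, and with approximate difference and sum
operations based at the point `x` that converge uniformly on the ball of radius `A`. -/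
structure LinearDilatations (Γ : Type*) [CommGroup Γ] {X : Type*} [MetricSpace X] (x : X) where
  ν : Γ → ℝ
  ν_pos : ∀ ε, 0 < ν ε
  ν_mul : ∀ ε μ, ν (ε * μ) = ν ε * ν μ
  ν_inf : ∀ a : ℝ, 0 < a → ∃ ε, ν ε < a
  δ : Γ → X → X → X
  fix : ∀ ε y, δ ε y y = y
  one : ∀ y u, δ 1 y u = u
  comp : ∀ ε μ y u, δ ε y (δ μ y u) = δ (ε * μ) y u
  continuous_δ : ∀ ε y, Continuous (δ ε y)
  tendsto_δ : ∀ y u, Tendsto (fun ε => δ ε y u) (nuFilter ν) (nhds y)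
  distrib : ∀ ε μ y z u, δ ε y (δ μ z u) = δ μ (δ ε y z) (δ ε y u)
  A : ℝ
  A_pos : 0 < A
  C : ℝ
  C_pos : 0 < C
  contract : ∃ a : ℝ, 0 < a ∧ ∀ ε, ν ε < a → ∀ y u, dist y u < A → dist y (δ ε y u) ≤ C * ν ε
  diff : X → X → X
  sum : X → X → X
  diff_approx : ∀ η : ℝ, 0 < η → ∀ᶠ ε in nuFilter ν, ∀ u v : X, dist x u < A → dist x v < A →
    dist (δ ε x (δ ε⁻¹ u v)) (diff u v) ≤ η
  sum_approx : ∀ η : ℝ, 0 < η → ∀ᶠ ε in nuFilter ν, ∀ u v : X, dist x u < A → dist x v < A →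
    dist (δ ε u (δ ε⁻¹ x v)) (sum u v) ≤ η

namespace LinearDilatations

variable {Γ : Type*} [CommGroup Γ] {X : Type*} [MetricSpace X] {x : X}
  (L : LinearDilatations Γ x)

theorem δ_inv_δ (ε : Γ) (y u : X) : L.δ ε⁻¹ y (L.δ ε y u) = u := by
  rw [L.comp, inv_mul_cancel, L.one]

theorem δ_δ_inv (ε : Γ) (y u : X) : L.δ ε y (L.δ ε⁻¹ y u) = u := by
  rw [L.comp, mul_inv_cancel, L.one]

theorem ν_one : L.ν 1 = 1 := by
  have h := L.ν_mul 1 1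
  have := L.ν_pos 1
  rw [mul_one] at h
  nlinarith

theorem neBot : (nuFilter L.ν).NeBot := by
  refine ⟨fun h => ?_⟩
  have h' : ∀ᶠ ε in nuFilter L.ν, False := by rw [h]; exact eventually_bot
  obtain ⟨a, ha, h''⟩ := (eventually_nuFilter L.ν_pos).1 h'
  obtain ⟨ε, hε⟩ := L.ν_inf a ha
  exact h'' ε hε

theorem eventually_ν_lt {a : ℝ} (ha : 0 < a) : ∀ᶠ ε in nuFilter L.ν, L.ν ε < a :=
  (eventually_nuFilter L.ν_pos).2 ⟨a, ha, fun _ h => h⟩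

theorem tendsto_mul_left (μ : Γ) :
    Tendsto (fun ε => μ * ε) (nuFilter L.ν) (nuFilter L.ν) := by
  intro s hs
  obtain ⟨a, ha, h⟩ := (eventually_nuFilter L.ν_pos).1 (show ∀ᶠ ε in nuFilter L.ν, ε ∈ s from hs)
  refine (eventually_nuFilter L.ν_pos).2 ⟨a / L.ν μ, div_pos ha (L.ν_pos μ), fun ε hε => h _ ?_⟩
  rw [L.ν_mul, mul_comm]
  exact (lt_div_iff₀ (L.ν_pos μ)).1 hε

theorem tendsto_pow {κ : Γ} (hκ : L.ν κ < 1) :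
    Tendsto (fun n : ℕ => κ ^ n) atTop (nuFilter L.ν) := by
  have hpow : ∀ n : ℕ, L.ν (κ ^ n) = L.ν κ ^ n := by
    intro n
    induction n with
    | zero => simp [L.ν_one]
    | succ n ih => rw [pow_succ, L.ν_mul, ih, pow_succ]
  intro s hs
  obtain ⟨a, ha, h⟩ := (eventually_nuFilter L.ν_pos).1 (show ∀ᶠ ε in nuFilter L.ν, ε ∈ s from hs)
  have := (tendsto_pow_atTop_nhds_zero_of_lt_one (L.ν_pos κ).le hκ).eventually_lt_const ha
  rw [Filter.mem_map]
  filter_upwards [this] with n hn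
  exact h _ (by rw [hpow]; exact hn)

/-- Eventually in `ε`, all the dilatations of coefficient `μ * ε` with `ν μ ≤ 1` contract. -/
theorem eventually_contract : ∀ᶠ ε in nuFilter L.ν, ∀ μ, L.ν μ ≤ 1 → ∀ y u, dist y u < L.A →
    dist y (L.δ (μ * ε) y u) ≤ L.C * L.ν ε := by
  obtain ⟨a, ha, h⟩ := L.contract
  filter_upwards [L.eventually_ν_lt ha] with ε hε μ hμ y u hu
  have hle : L.ν (μ * ε) ≤ L.ν ε := by
    rw [L.ν_mul]
    exact mul_le_of_le_one_left (L.ν_pos ε).le hμ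
  exact (h _ (hle.trans_lt hε) y u hu).trans (mul_le_mul_of_nonneg_left hle L.C_pos.le)

/-- Continuity at the base point `x` of the dilatation `δ ε x`. -/
theorem eventually_dist_δ_lt (ε : Γ) {η : ℝ} (hη : 0 < η) :
    ∃ r : ℝ, 0 < r ∧ ∀ u, dist x u < r → dist x (L.δ ε x u) < η := by
  obtain ⟨r, hr, h⟩ := Metric.continuousAt_iff.1 (L.continuous_δ ε x).continuousAt η hη
  refine ⟨r, hr, fun u hu => ?_⟩
  have := h (x := u) (by rwa [dist_comm])
  rwa [L.fix, dist_comm] at this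

/-- The dilatations based at `x` of coefficient at most `1` are equicontinuous at `x`. -/
theorem equicontinuous_at_base {η : ℝ} (hη : 0 < η) :
    ∃ r : ℝ, 0 < r ∧ ∀ u, dist x u < r → ∀ μ, L.ν μ ≤ 1 → dist x (L.δ μ x u) < η := by
  have := L.neBot
  obtain ⟨ε, h, hε⟩ :=
    (L.eventually_contract.and (L.eventually_ν_lt (div_pos hη L.C_pos))).exists
  obtain ⟨r, hr, hr'⟩ := L.eventually_dist_δ_lt ε⁻¹ L.A_pos
  refine ⟨r, hr, fun u hu μ hμ => ?_⟩
  have := h μ hμ x _ (hr' u hu)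
  rw [← L.comp, L.δ_δ_inv] at this
  refine this.trans_lt ?_
  rw [mul_comm]
  exact (lt_div_iff₀ L.C_pos).1 hε

/-- A family of operations that commutes with the dilatations based at `x` and converges uniformly
on a ball converges everywhere, continuously in the second variable. -/
theorem exists_limit {F : Γ → X → X → X} {f : X → X → X} (hF : ∀ ε u, Continuous (F ε u))
    (hδ : ∀ κ ε u v, L.δ κ x (F ε u v) = F ε (L.δ κ x u) (L.δ κ x v))
    (hf : ∀ η : ℝ, 0 < η → ∀ᶠ ε in nuFilter L.ν, ∀ u v : X, dist x u < L.A → dist x v < L.A →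
      dist (F ε u v) (f u v) ≤ η) :
    ∃ g : X → X → X,
      (∀ u y (s : Γ → X), Tendsto s (nuFilter L.ν) (nhds y) →
        Tendsto (fun ε => F ε u (s ε)) (nuFilter L.ν) (nhds (g u y))) ∧
      ∀ u v, dist x u < L.A → dist x v < L.A → g u v = f u v := by
  have := L.neBot
  have hball : ∀ u, dist x u < L.A → TendstoUniformlyOn (fun ε => F ε u) (f u) (nuFilter L.ν)
      (Metric.ball x L.A) := by
    intro u hu
    rw [Metric.tendstoUniformlyOn_iff]
    intro η hη
    filter_upwards [hf (η / 2) (half_pos hη)] with ε hε v hv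
    rw [dist_comm]
    exact (hε u v hu (by rwa [Metric.mem_ball'] at hv)).trans_lt (half_lt_self hη)
  have hlocal : ∀ u y (s : Γ → X), dist x u < L.A → dist x y < L.A →
      Tendsto s (nuFilter L.ν) (nhds y) →
      Tendsto (fun ε => F ε u (s ε)) (nuFilter L.ν) (nhds (f u y)) := by
    intro u y s hu hy hs
    have hy' : y ∈ Metric.ball x L.A := by rwa [Metric.mem_ball']
    have hc : ContinuousOn (f u) (Metric.ball x L.A) :=
      (hball u hu).continuousOn (Frequently.of_forall fun ε => (hF ε u).continuousOn)
    refine (hball u hu).tendsto_comp (hc y hy') ?_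
    rwa [Metric.isOpen_ball.nhdsWithin_eq hy']
  have hex : ∀ u y, ∃ z, ∀ s : Γ → X, Tendsto s (nuFilter L.ν) (nhds y) →
      Tendsto (fun ε => F ε u (s ε)) (nuFilter L.ν) (nhds z) := by
    intro u y
    have hsmall : ∀ v, ∀ᶠ κ in nuFilter L.ν, dist x (L.δ κ x v) < L.A := by
      intro v
      have := (L.tendsto_δ x v).eventually (Metric.ball_mem_nhds x L.A_pos)
      filter_upwards [this] with κ hκ
      rwa [dist_comm] at hκ
    obtain ⟨κ, hu, hy⟩ := ((hsmall u).and (hsmall y)).exists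
    refine ⟨L.δ κ⁻¹ x (f (L.δ κ x u) (L.δ κ x y)), fun s hs => ?_⟩
    have h1 := hlocal _ _ (fun ε => L.δ κ x (s ε)) hu hy
      (((L.continuous_δ κ x).tendsto y).comp hs)
    have h2 := ((L.continuous_δ κ⁻¹ x).tendsto _).comp h1
    refine h2.congr fun ε => ?_
    simp only [Function.comp_apply]
    rw [← hδ, L.δ_inv_δ]
  choose g hg using hex
  exact ⟨g, hg, fun u v hu hv => tendsto_nhds_unique (hg u v _ tendsto_const_nhds)
    (hlocal u v _ hu hv tendsto_const_nhds)⟩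

/-- The approximate difference based at `x`. -/
def approxDiff (ε : Γ) (u v : X) : X := L.δ ε x (L.δ ε⁻¹ u v)

/-- The approximate sum based at `x`. -/
def approxSum (ε : Γ) (u v : X) : X := L.δ ε u (L.δ ε⁻¹ x v)

theorem approxSum_approxDiff (ε : Γ) (u v : X) : L.approxSum ε u (L.approxDiff ε u v) = v := by
  rw [approxSum, approxDiff, L.δ_inv_δ, L.δ_δ_inv]

theorem approxDiff_approxSum (ε : Γ) (u v : X) : L.approxDiff ε u (L.approxSum ε u v) = v := by
  rw [approxSum, approxDiff, L.δ_inv_δ, L.δ_δ_inv]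

theorem approxDiff_self (ε : Γ) (u : X) : L.approxDiff ε u u = L.δ ε x u := by
  rw [approxDiff, L.fix]

theorem continuous_approxDiff (ε : Γ) (u : X) : Continuous (L.approxDiff ε u) :=
  (L.continuous_δ _ _).comp (L.continuous_δ _ _)

theorem continuous_approxSum (ε : Γ) (u : X) : Continuous (L.approxSum ε u) :=
  (L.continuous_δ _ _).comp (L.continuous_δ _ _)

theorem approxDiff_δ (ε μ : Γ) (u y v : X) :
    L.approxDiff ε u (L.δ μ y v) = L.δ μ (L.approxDiff ε u y) (L.approxDiff ε u v) := by
  simp only [approxDiff, L.distrib ε⁻¹ μ, L.distrib ε μ]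

theorem δ_approxDiff (κ ε : Γ) (u v : X) :
    L.δ κ x (L.approxDiff ε u v) = L.approxDiff ε (L.δ κ x u) (L.δ κ x v) := by
  rw [approxDiff, L.distrib κ ε, L.fix, L.distrib κ ε⁻¹, approxDiff]

theorem δ_approxSum (κ ε : Γ) (u v : X) :
    L.δ κ x (L.approxSum ε u v) = L.approxSum ε (L.δ κ x u) (L.δ κ x v) := by
  rw [approxSum, L.distrib κ ε, L.distrib κ ε⁻¹, L.fix, approxSum]

/-- The difference operation based at `x`, extended to the whole space. -/
noncomputable def diffLim : X → X → X :=
  (L.exists_limit L.continuous_approxDiff L.δ_approxDiff L.diff_approx).choose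

/-- The sum operation based at `x`, extended to the whole space. -/
noncomputable def sumLim : X → X → X :=
  (L.exists_limit L.continuous_approxSum L.δ_approxSum L.sum_approx).choose

theorem tendsto_approxDiff {u y : X} {s : Γ → X} (hs : Tendsto s (nuFilter L.ν) (nhds y)) :
    Tendsto (fun ε => L.approxDiff ε u (s ε)) (nuFilter L.ν) (nhds (L.diffLim u y)) :=
  (L.exists_limit L.continuous_approxDiff L.δ_approxDiff L.diff_approx).choose_spec.1 u y s hs

theorem tendsto_approxSum {u y : X} {s : Γ → X} (hs : Tendsto s (nuFilter L.ν) (nhds y)) :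
    Tendsto (fun ε => L.approxSum ε u (s ε)) (nuFilter L.ν) (nhds (L.sumLim u y)) :=
  (L.exists_limit L.continuous_approxSum L.δ_approxSum L.sum_approx).choose_spec.1 u y s hs

theorem diffLim_eq {u v : X} (hu : dist x u < L.A) (hv : dist x v < L.A) :
    L.diffLim u v = L.diff u v :=
  (L.exists_limit L.continuous_approxDiff L.δ_approxDiff L.diff_approx).choose_spec.2 u v hu hv

theorem sumLim_eq {u v : X} (hu : dist x u < L.A) (hv : dist x v < L.A) :
    L.sumLim u v = L.sum u v :=
  (L.exists_limit L.continuous_approxSum L.δ_approxSum L.sum_approx).choose_spec.2 u v hu hv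

theorem sumLim_diffLim (u v : X) : L.sumLim u (L.diffLim u v) = v := by
  have := L.neBot
  refine tendsto_nhds_unique
    (L.tendsto_approxSum (L.tendsto_approxDiff (u := u) tendsto_const_nhds)) ?_
  simp only [L.approxSum_approxDiff]
  exact tendsto_const_nhds

theorem diffLim_sumLim (u v : X) : L.diffLim u (L.sumLim u v) = v := by
  have := L.neBot
  refine tendsto_nhds_unique
    (L.tendsto_approxDiff (L.tendsto_approxSum (u := u) tendsto_const_nhds)) ?_
  simp only [L.approxDiff_approxSum]
  exact tendsto_const_nhds

theorem δ_diffLim (κ : Γ) (u v : X) :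
    L.δ κ x (L.diffLim u v) = L.diffLim (L.δ κ x u) (L.δ κ x v) := by
  have := L.neBot
  refine tendsto_nhds_unique (((L.continuous_δ κ x).tendsto _).comp
    (L.tendsto_approxDiff (u := u) (tendsto_const_nhds (x := v)))) ?_
  refine (L.tendsto_approxDiff (u := L.δ κ x u)
    (tendsto_const_nhds (x := L.δ κ x v))).congr fun ε => ?_
  exact (L.δ_approxDiff κ ε u v).symm

theorem δ_sumLim (μ : Γ) (u y : X) : L.δ μ u (L.sumLim u y) = L.sumLim u (L.δ μ x y) := by
  have := L.neBot
  have h1 := (L.tendsto_approxSum (u := u) (tendsto_const_nhds (x := L.δ μ x y))).comp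
    (L.tendsto_mul_left μ)
  have h2 := ((L.continuous_δ μ u).tendsto _).comp
    (L.tendsto_approxSum (u := u) (tendsto_const_nhds (x := y)))
  refine tendsto_nhds_unique h2 (h1.congr fun ε => ?_)
  simp only [Function.comp_apply, approxSum, L.comp]
  congr 2
  group

/-- The dilatations are those of the limit operations at `x`. -/
theorem δ_eq_sumLim (μ : Γ) (u v : X) : L.δ μ u v = L.sumLim u (L.δ μ x (L.diffLim u v)) := by
  rw [← L.δ_sumLim, L.sumLim_diffLim]

theorem diffLim_δ (μ : Γ) (u v : X) : L.diffLim u (L.δ μ u v) = L.δ μ x (L.diffLim u v) := by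
  rw [L.δ_eq_sumLim, L.diffLim_sumLim]

/-- Continuity of the dilatations in the base point, along the curves `δ μ x u`, `μ → 0`. -/
theorem tendsto_δ_base (ε : Γ) (u y : X) :
    Tendsto (fun μ => L.δ ε (L.δ μ x u) y) (nuFilter L.ν) (nhds (L.δ ε x y)) := by
  have h := L.tendsto_approxDiff (u := u) (((L.continuous_δ ε u).tendsto _).comp
    (L.tendsto_approxSum (u := u) (tendsto_const_nhds (x := y))))
  rw [L.diffLim_δ, L.diffLim_sumLim] at h
  refine h.congr fun μ => ?_
  simp only [Function.comp_apply]
  rw [L.approxDiff_δ, L.approxDiff_self, L.approxDiff_approxSum]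

/-- The approximate inverse of `u`, added to `v`, is the approximate difference. -/
theorem sumLim_approxDiff_base (ε : Γ) (u v : X) :
    L.sumLim (L.approxDiff ε u x) v = L.approxDiff ε u v := by
  have := L.neBot
  have h1 := L.tendsto_approxSum (u := L.approxDiff ε u x) (tendsto_const_nhds (x := v))
  have h2 := ((L.continuous_approxDiff ε u).tendsto _).comp
    (L.tendsto_δ_base ε u (L.δ ε⁻¹ x v))
  rw [L.δ_δ_inv] at h2
  refine tendsto_nhds_unique h1 (h2.congr fun μ => ?_)
  simp only [Function.comp_apply]
  have h3 : L.δ ε (L.δ μ x u) (L.δ ε⁻¹ x v)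
      = L.δ μ x (L.approxSum ε u (L.δ μ⁻¹ x v)) := by
    rw [L.δ_approxSum, L.δ_δ_inv, approxSum]
  have h4 := L.approxDiff_δ ε μ u x (L.approxSum ε u (L.δ μ⁻¹ x v))
  rw [h3, h4, L.approxDiff_approxSum, approxSum]

/-- Adding a point close to `x` on the right moves the points of the ball by a small amount. -/
theorem dist_sumLim_lt {η : ℝ} (hη : 0 < η) :
    ∃ r : ℝ, 0 < r ∧ ∀ u v, dist x u < L.A / 2 → dist x v < r → dist u (L.sumLim u v) < η := by
  have := L.neBot
  have hA := L.A_pos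
  obtain ⟨μ, ⟨h1, h2⟩, h3⟩ := ((L.eventually_contract.and
    (L.eventually_ν_lt (div_pos (half_pos hη) L.C_pos))).and
    (L.sum_approx (η / 2) (half_pos hη))).exists
  obtain ⟨r, hr, hr'⟩ := L.eventually_dist_δ_lt μ⁻¹ (half_pos hA)
  refine ⟨min r L.A, lt_min hr hA, fun u v hu hv => ?_⟩
  have hu' : dist x u < L.A := by linarith
  have hv' : dist x v < L.A := hv.trans_le (min_le_right _ _)
  have hb := hr' v (hv.trans_le (min_le_left _ _))
  have h4 := h1 1 L.ν_one.le u (L.δ μ⁻¹ x v) (by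
    have := dist_triangle u x (L.δ μ⁻¹ x v)
    rw [dist_comm u x] at this
    linarith)
  rw [one_mul] at h4
  have h5 := h3 u v hu' hv'
  rw [← L.sumLim_eq hu' hv'] at h5
  have h6 : L.C * L.ν μ < η / 2 := by
    rw [mul_comm]
    exact (lt_div_iff₀ L.C_pos).1 h2
  have := dist_triangle u (L.δ μ u (L.δ μ⁻¹ x v)) (L.sumLim u v)
  linarith

theorem diffLim_base_small_of_lt {η : ℝ} (hη : 0 < η) :
    ∃ r : ℝ, 0 < r ∧ ∀ u, dist x u < r → dist x (L.diffLim u x) < L.A / 2 →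
      dist x (L.diffLim u x) < η := by
  have := L.neBot
  obtain ⟨r, hr, h⟩ := L.dist_sumLim_lt (half_pos hη)
  refine ⟨r, hr, fun u hu hw => ?_⟩
  have ht := L.tendsto_approxDiff (u := u) (tendsto_const_nhds (x := x))
  have hd : Tendsto (fun ε => dist x (L.approxDiff ε u x)) (nuFilter L.ν)
      (nhds (dist x (L.diffLim u x))) := tendsto_const_nhds.dist ht
  have hle : dist (L.diffLim u x) x ≤ η / 2 := by
    refine le_of_tendsto (ht.dist (L.tendsto_δ x u)) ?_
    filter_upwards [hd.eventually_lt_const hw] with ε hε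
    have := h _ u hε hu
    rw [L.sumLim_approxDiff_base, L.approxDiff_self] at this
    exact this.le
  rw [dist_comm]
  linarith

/-- Continuity at `x` of the inverse operation. -/
theorem diffLim_base_small {η : ℝ} (hη : 0 < η) :
    ∃ r : ℝ, 0 < r ∧ ∀ u, dist x u < r → dist x (L.diffLim u x) < η := by
  have := L.neBot
  obtain ⟨κ, hκ⟩ := L.ν_inf 1 one_pos
  obtain ⟨θ, hθ, hθ'⟩ := L.eventually_dist_δ_lt κ⁻¹ (half_pos L.A_pos)
  obtain ⟨r, hr, h⟩ := L.diffLim_base_small_of_lt (lt_min hη hθ)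
  obtain ⟨r', hr', h'⟩ := L.equicontinuous_at_base hr
  refine ⟨r', hr', fun u hu => ?_⟩
  have hpow : ∀ n : ℕ, L.ν (κ ^ n) ≤ 1 := by
    intro n
    induction n with
    | zero => simp [L.ν_one]
    | succ n ih =>
      rw [pow_succ, L.ν_mul]
      exact mul_le_one₀ ih (L.ν_pos κ).le hκ.le
  have hscale : ∀ μ, L.δ μ x (L.diffLim u x) = L.diffLim (L.δ μ x u) x := by
    intro μ
    rw [L.δ_diffLim, L.fix]
  have hstep : ∀ n : ℕ, dist x (L.δ (κ ^ n) x (L.diffLim u x)) < L.A / 2 →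
      dist x (L.δ (κ ^ n) x (L.diffLim u x)) < min η θ := by
    intro n hn
    rw [hscale] at hn ⊢
    exact h _ (h' u hu _ (hpow n)) hn
  have hlim := ((L.tendsto_δ x (L.diffLim u x)).comp (L.tendsto_pow hκ)).eventually
    (Metric.ball_mem_nhds x (half_pos L.A_pos))
  obtain ⟨N, hN⟩ := hlim.exists
  rw [dist_comm] at hN
  have hdown : ∀ n : ℕ, dist x (L.δ (κ ^ n) x (L.diffLim u x)) < min η θ →
      dist x (L.diffLim u x) < min η θ := by
    intro n
    induction n with
    | zero => intro hn; rwa [pow_zero, L.one] at hn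
    | succ n ih =>
      intro hn
      refine ih (hstep n ?_)
      have := hθ' _ (hn.trans_le (min_le_right _ _))
      rwa [L.comp, pow_succ', inv_mul_cancel_left] at this
  exact (hdown N (hstep N hN)).trans_le (min_le_left _ _)

/-- Continuity at `(x, x)` of the difference operation. -/
theorem diffLim_small {η : ℝ} (hη : 0 < η) :
    ∃ r : ℝ, 0 < r ∧ ∀ u v, dist x u < r → dist x v < r → dist x (L.diffLim u v) < η := by
  have := L.neBot
  have hA := L.A_pos
  obtain ⟨r₁, hr₁, h₁⟩ := L.dist_sumLim_lt (show 0 < η / 3 by linarith)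
  obtain ⟨r₂, hr₂, h₂⟩ := L.diffLim_base_small (lt_min (half_pos hA) (show 0 < η / 3 by linarith))
  refine ⟨min r₁ r₂, lt_min hr₁ hr₂, fun u v hu hv => ?_⟩
  have hw := h₂ u (hu.trans_le (min_le_right _ _))
  have hd : Tendsto (fun ε => dist x (L.approxDiff ε u x)) (nuFilter L.ν)
      (nhds (dist x (L.diffLim u x))) :=
    tendsto_const_nhds.dist (L.tendsto_approxDiff (u := u) (tendsto_const_nhds (x := x)))
  have hle : dist x (L.diffLim u v) ≤ η / 3 + η / 3 := by
    refine le_of_tendsto (tendsto_const_nhds.dist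
      (L.tendsto_approxDiff (u := u) (tendsto_const_nhds (x := v)))) ?_
    filter_upwards [hd.eventually_lt_const hw] with ε hε
    have h3 := h₁ _ v (hε.trans_le (min_le_left _ _)) (hv.trans_le (min_le_left _ _))
    rw [L.sumLim_approxDiff_base] at h3
    have h4 := hε.trans_le (min_le_right _ _)
    have := dist_triangle x (L.approxDiff ε u x) (L.approxDiff ε u v)
    linarith
  linarith

/-- Near `x`, the dilatations are those of the conical group at `x`. -/
theorem exists_δ_eq_sum :
    ∃ r : ℝ, 0 < r ∧ ∀ u v, dist x u ≤ r → dist x v ≤ r → ∀ μ, L.ν μ < 1 →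
      L.δ μ u v = L.sum u (L.δ μ x (L.diff u v)) := by
  have hA := L.A_pos
  obtain ⟨r₁, hr₁, h₁⟩ := L.equicontinuous_at_base hA
  obtain ⟨r₂, hr₂, h₂⟩ := L.diffLim_small hr₁
  have hm : 0 < min r₂ L.A := lt_min hr₂ hA
  refine ⟨min r₂ L.A / 2, half_pos hm, fun u v hu hv μ hμ => ?_⟩
  have hu' := hu.trans_lt (half_lt_self hm)
  have hv' := hv.trans_lt (half_lt_self hm)
  have huA := hu'.trans_le (min_le_right _ _)
  have hvA := hv'.trans_le (min_le_right _ _)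
  have hw := h₁ _ (h₂ u v (hu'.trans_le (min_le_left _ _)) (hv'.trans_le (min_le_left _ _))) μ hμ.le
  rw [L.δ_eq_sumLim, L.sumLim_eq huA hw, L.diffLim_eq huA hvA]

end LinearDilatations

namespace DilStruct

variable {Γ : Type*} [CommGroup Γ] {X : Type*} (S : DilStruct Γ X)

theorem ν_one : S.ν 1 = 1 := by
  have h := S.ν_hom 1 1
  have := S.ν_pos 1
  rw [mul_one] at h
  nlinarith

theorem ν_inv (ε : Γ) : S.ν ε⁻¹ = (S.ν ε)⁻¹ := by
  have h := S.ν_hom ε⁻¹ ε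
  rw [inv_mul_cancel, S.ν_one] at h
  exact eq_inv_of_mul_eq_one_left h.symm

theorem δ_mul_inv (ε : Γ) (x u : X) : S.δ ε x (S.δ ε⁻¹ x u) = u := by
  rw [S.δ_comp, mul_inv_cancel, S.δ_one]

/-- If the dilatations are linear, they are automorphisms of the family of dilatations. -/
theorem distrib (hlin : ∀ μ : Γ, S.ν μ ≤ 1 → ∀ y : X, S.toWeakDilStruct.IsLinear (S.δ μ y))
    (ε μ : Γ) (y z u : X) : S.δ ε y (S.δ μ z u) = S.δ μ (S.δ ε y z) (S.δ ε y u) := by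
  have key : ∀ ε : Γ, S.ν ε ≤ 1 → ∀ (μ : Γ) (y z u : X),
      S.δ ε y (S.δ μ z u) = S.δ μ (S.δ ε y z) (S.δ ε y u) := by
    intro ε hε μ y z u
    obtain ⟨σ, hσ⟩ := S.ν_inf (min 1 (S.ν μ)⁻¹) (lt_min one_pos (inv_pos.2 (S.ν_pos μ)))
    have hσ1 : S.ν σ < 1 := hσ.trans_le (min_le_left _ _)
    have hμσ : S.ν (μ * σ) < 1 := by
      rw [S.ν_hom, mul_comm]
      have := (lt_div_iff₀ (S.ν_pos μ)).1
        (show S.ν σ < 1 / S.ν μ by rw [one_div]; exact hσ.trans_le (min_le_right _ _))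
      exact this
    have hinv : S.δ ε y (S.δ σ⁻¹ z u) = S.δ σ⁻¹ (S.δ ε y z) (S.δ ε y u) := by
      have h := (hlin ε hε y).2 σ hσ1 z (S.δ σ⁻¹ z u)
      rw [S.δ_mul_inv] at h
      rw [h, S.δ_inv]
    have h := (hlin ε hε y).2 (μ * σ) hμσ z (S.δ σ⁻¹ z u)
    rw [hinv, S.δ_comp, S.δ_comp, mul_inv_cancel_right] at h
    exact h
  rcases le_total (S.ν ε) 1 with hε | hε
  · exact key ε hε μ y z u
  · have hε' : S.ν ε⁻¹ ≤ 1 := by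
      rw [S.ν_inv]
      exact inv_le_one_of_one_le₀ hε
    have h := key ε⁻¹ hε' μ y (S.δ ε y z) (S.δ ε y u)
    rw [S.δ_inv, S.δ_inv] at h
    rw [← h, S.δ_mul_inv]

/-- The metric space structure given by the distance of a dilatation structure. -/
abbrev toMetricSpace : MetricSpace X where
  dist := S.d
  dist_self := S.d_self
  dist_comm := S.d_symm
  dist_triangle := S.d_triangle
  eq_of_dist_eq_zero := fun {x y} h => S.d_nondeg x y h

theorem d_nonneg (x y : X) : 0 ≤ S.d x y := by
  have h := S.d_triangle x y x
  rw [S.d_self, S.d_symm y x] at h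
  linarith

theorem Δ_self {x u : X} (hu : S.d x u ≤ S.A) : S.Δ x u u = x := by
  refine (S.d_nondeg _ _ (le_antisymm (le_of_forall_pos_le_add fun η hη => ?_)
    (S.d_nonneg _ _))).symm
  obtain ⟨a, ha, h⟩ := S.axA4 (η / 2) (half_pos hη)
  have hlim := (S.δ_lim x u).eventually_lt_const (half_pos hη)
  obtain ⟨b, hb, h'⟩ := (eventually_nuFilter S.ν_pos).1 hlim
  obtain ⟨ε, hε⟩ := S.ν_inf (min a b) (lt_min ha hb)
  have h1 := h ε (hε.trans_le (min_le_left _ _)) x u u hu hu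
  have h2 := h' ε (hε.trans_le (min_le_right _ _))
  rw [S.δ_fix] at h1
  have h3 := S.d_triangle x (S.δ ε x u) (S.Δ x u u)
  rw [S.d_symm x (S.δ ε x u)] at h3
  linarith

/-- The dilatations of small coefficient contract, uniformly over all base points. -/
theorem exists_contract : ∃ C : ℝ, 0 < C ∧ ∃ a : ℝ, 0 < a ∧ ∀ ε, S.ν ε < a → ∀ y u,
    S.d y u ≤ S.A → S.d y (S.δ ε y u) ≤ C * S.ν ε := by
  obtain ⟨a, ha, h3⟩ := S.axA3 1 one_pos
  obtain ⟨b, hb, h4⟩ := S.axA4 1 one_pos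
  obtain ⟨ε₀, hε₀⟩ := S.ν_inf (min a b) (lt_min ha hb)
  have hpos := S.ν_pos ε₀
  refine ⟨1 / S.ν ε₀ + 2, by positivity, a, ha, fun ε hε y u hu => ?_⟩
  have hy : S.d y y ≤ S.A := by
    rw [S.d_self]
    linarith [S.one_lt_A]
  have h1 := h4 ε₀ (hε₀.trans_le (min_le_right _ _)) y u u hu hu
  rw [S.δ_fix, S.Δ_self hu, S.d_symm] at h1
  have h2 := (abs_le.1 (h3 ε₀ (hε₀.trans_le (min_le_left _ _)) y y u hy hu)).1
  have h5 := (abs_le.1 (h3 ε hε y y u hy hu)).2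
  rw [S.δ_fix] at h2 h5
  have h6 : S.d y (S.δ ε₀ y u) / S.ν ε₀ ≤ 1 / S.ν ε₀ := div_le_div_of_nonneg_right h1 hpos.le
  exact (div_le_iff₀ (S.ν_pos ε)).1 (by linarith)

/-- The linear dilatations on the metric space underlying a dilatation structure. -/
theorem exists_linearDilatations
    (hlin : ∀ μ : Γ, S.ν μ ≤ 1 → ∀ y : X, S.toWeakDilStruct.IsLinear (S.δ μ y))
    (Sig : X → X → X) (x : X)
    (hSig : ∀ η : ℝ, 0 < η → ∃ a : ℝ, 0 < a ∧ ∀ ε : Γ, S.ν ε < a → ∀ u v : X,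
        S.d x u ≤ S.A → S.d x v ≤ S.A →
        S.d (S.δ ε⁻¹ x (S.δ ε (S.δ ε x u) v)) (Sig u v) ≤ η) :
    letI := S.toMetricSpace
    ∃ L : LinearDilatations Γ x, L.ν = S.ν ∧ L.δ = S.δ ∧ L.diff = S.Δ x ∧ L.sum = Sig := by
  let _ := S.toMetricSpace
  obtain ⟨C, hC, a, ha, hcontract⟩ := S.exists_contract
  have hdist := S.distrib hlin
  exact ⟨{
    ν := S.ν
    ν_pos := S.ν_pos
    ν_mul := S.ν_hom
    ν_inf := S.ν_inf
    δ := S.δ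
    fix := S.δ_fix
    one := S.δ_one
    comp := S.δ_comp
    continuous_δ := by
      intro ε y
      rw [Metric.continuous_iff]
      intro z η hη
      obtain ⟨θ, hθ, h⟩ := S.δ_cont ε y z η hη
      refine ⟨θ, hθ, fun z' hz' => ?_⟩
      rw [dist_comm] at hz' ⊢
      exact h z' hz'
    tendsto_δ := fun y u => tendsto_iff_dist_tendsto_zero.2 (S.δ_lim y u)
    distrib := hdist
    A := S.A
    A_pos := one_pos.trans S.one_lt_A
    C := C
    C_pos := hC
    contract := ⟨a, ha, fun ε hε y u hu => hcontract ε hε y u (le_of_lt hu)⟩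
    diff := S.Δ x
    sum := Sig
    diff_approx := by
      intro η hη
      obtain ⟨b, hb, h⟩ := S.axA4 η hη
      refine (eventually_nuFilter S.ν_pos).2 ⟨b, hb, fun ε hε u v hu hv => ?_⟩
      rw [hdist]
      exact h ε hε x u v (le_of_lt hu) (le_of_lt hv)
    sum_approx := by
      intro η hη
      obtain ⟨b, hb, h⟩ := hSig η hη
      refine (eventually_nuFilter S.ν_pos).2 ⟨b, hb, fun ε hε u v hu hv => ?_⟩
      have := h ε hε u v (le_of_lt hu) (le_of_lt hv)
      rw [hdist ε⁻¹, S.δ_inv] at this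
      exact this }, rfl, rfl, rfl, rfl⟩

end DilStruct

/-- The dilatations `x * dil ε (x⁻¹ * u)` of a group with dilatations commute as linear
transformations do. -/
theorem group_dilatations_distrib {Γ : Type*} [CommGroup Γ] {G : Type*} [Group G] (dil : Γ → G → G)
    (hmul : ∀ (ε : Γ) (a b : G), dil ε (a * b) = dil ε a * dil ε b)
    (hcomp : ∀ (ε μ : Γ) (a : G), dil ε (dil μ a) = dil (ε * μ) a) (ε μ : Γ) (x y u : G) :
    x * dil ε (x⁻¹ * (y * dil μ (y⁻¹ * u)))
      = (x * dil ε (x⁻¹ * y)) * dil μ ((x * dil ε (x⁻¹ * y))⁻¹ * (x * dil ε (x⁻¹ * u))) := by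
  have h1 : (x * dil ε (x⁻¹ * y))⁻¹ * (x * dil ε (x⁻¹ * u)) = dil ε (y⁻¹ * u) := by
    rw [inv_mul_eq_iff_eq_mul, mul_assoc, ← hmul]
    congr 2
    group
  rw [h1, hcomp, mul_comm μ ε, ← hcomp, mul_assoc, ← hmul, mul_assoc]

/-- **Theorem.** Let `(X,d,δ)` be a strong dilatation structure whose dilatations are all
linear transformations, and let `Σ^x = Sig x` be the tangent sum operations (the uniform limits
of `Σ^x_ε`). Then for all `x, u, v` sufficiently close and all `μ ∈ Γ` with `ν(μ) < 1`,
`δ^u_μ v = Σ^x( u, δ^x_μ Δ^x(u,v) )`: the dilatations are exactly those of the dilatation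
structure of the conical group `T_xX = (U(x), Σ^x, δ^x)`. Conversely, the dilatations
`δ^x_ε u = x·dilₑ(x⁻¹ u)` of the dilatation structure of any conical group are linear:
they satisfy the commutation relation `δ^x_ε (δ^y_μ u) = δ^{δ^x_ε y}_μ (δ^x_ε u)`. -/
theorem linear_dilatations_conical {Γ : Type*} [CommGroup Γ] {X : Type*}
    (S : DilStruct Γ X)
    (hlin : ∀ μ : Γ, S.ν μ ≤ 1 → ∀ y : X, S.toWeakDilStruct.IsLinear (S.δ μ y))
    (Sig : X → X → X → X)
    (hSig : ∀ x : X, ∀ η : ℝ, 0 < η → ∃ a : ℝ, 0 < a ∧ ∀ ε : Γ, S.ν ε < a → ∀ u v : X,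
        S.d x u ≤ S.A → S.d x v ≤ S.A →
        S.d (S.δ ε⁻¹ x (S.δ ε (S.δ ε x u) v)) (Sig x u v) ≤ η) :
    (∀ x : X, ∃ r : ℝ, 0 < r ∧ ∀ u v : X, S.d x u ≤ r → S.d x v ≤ r →
        ∀ μ : Γ, S.ν μ < 1 →
          S.δ μ u v = Sig x u (S.δ μ x (S.Δ x u v))) ∧
    (∀ (G : Type) [Group G] (dil : Γ → G → G),
        (∀ (ε : Γ) (a b : G), dil ε (a * b) = dil ε a * dil ε b) →
        (∀ (ε μ : Γ) (a : G), dil ε (dil μ a) = dil (ε * μ) a) →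
        ∀ (ε μ : Γ) (x y u : G),
          x * dil ε (x⁻¹ * (y * dil μ (y⁻¹ * u)))
            = (x * dil ε (x⁻¹ * y)) * dil μ ((x * dil ε (x⁻¹ * y))⁻¹ * (x * dil ε (x⁻¹ * u)))) := by
  refine ⟨fun x => ?_, fun G _ dil hmul hcomp => group_dilatations_distrib dil hmul hcomp⟩
  let _ := S.toMetricSpace
  obtain ⟨L, hν, hδ, hdiff, hsum⟩ := S.exists_linearDilatations hlin (Sig x) x (hSig x)
  obtain ⟨r, hr, h⟩ := L.exists_δ_eq_sum
  rw [hν, hδ, hdiff, hsum] at h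
  exact ⟨r, hr, h⟩
end
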